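/- Let Ω ⊆ ℂⁿ be a domain, let α ∈ (ℤ₊)ⁿ, and let (f_k)_{k∈ℕ} be a sequence of α-analytic functions on Ω that converges uniformly on Ω to a function f. Then f is α-analytic on Ω. -/

import Mathlib

noncomputable section

/-- The Wirtinger derivative `∂/∂z̄_j = ½(∂/∂x_j + i ∂/∂y_j)` of `f : ℂⁿ → ℂ`. -/
def wirtingerBar (n : ℕ) (j : Fin n) (f : (Fin n → ℂ) → ℂ) : (Fin n → ℂ) → ℂ :=
  fun z => (1 / 2 : ℂ) *
    (fderiv ℝ f z (Pi.single j 1) + Complex.I * fderiv ℝ f z (Pi.single j Complex.I))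

/-- `f` is `α`-analytic (polyanalytic of order `α`) on `Ω ⊆ ℂⁿ`: it is smooth and
`(∂/∂z̄_j)^{α_j} f = 0` on `Ω` for each `j`. -/
def PolyanalyticOn (n : ℕ) (α : Fin n → ℕ) (f : (Fin n → ℂ) → ℂ)
    (Ω : Set (Fin n → ℂ)) : Prop :=
  ContDiffOn ℝ (⊤ : ℕ∞) f Ω ∧ ∀ j : Fin n, ∀ z ∈ Ω, ((wirtingerBar n j)^[α j] f) z = 0

open Metric Set Filter Topology

/-- If `g 0, g 1, …, g α` are the iterated Wirtinger derivatives of `g 0` and `g α = 0`, then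
`g 0 z = ∑_{m < α} conj z ^ m * a m z` with holomorphic coefficients `a m`. -/
lemma exists_holomorphic_coeffs {U : Set ℂ} (hU : IsOpen U) (α : ℕ) (g : ℕ → ℂ → ℂ)
    (hd : ∀ m < α, ∀ t ∈ U, DifferentiableAt ℝ (g m) t)
    (hg : ∀ m < α, ∀ t ∈ U,
      fderiv ℝ (g m) t 1 + Complex.I * fderiv ℝ (g m) t Complex.I = 2 * g (m + 1) t)
    (h0 : ∀ t ∈ U, g α t = 0) :
    ∃ a : ℕ → ℂ → ℂ, (∀ m, DifferentiableOn ℂ (a m) U) ∧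
      ∀ t ∈ U, g 0 t = ∑ m ∈ Finset.range α, (starRingEnd ℂ) t ^ m * a m t := by
  induction α generalizing g with
  | zero => exact ⟨fun _ _ => 0, fun _ => differentiableOn_const _, by simpa using h0⟩
  | succ α ih =>
    obtain ⟨b, hb, hgb⟩ := ih (fun m => g (m + 1)) (fun m hm => hd _ (by omega))
      (fun m hm => hg _ (by omega)) h0
    set p : ℂ → ℂ := fun t => ∑ m ∈ Finset.range α,
      (starRingEnd ℂ) t ^ (m + 1) * (((m : ℂ) + 1)⁻¹ * b m t) with hp
    have hbt : ∀ m, ∀ t ∈ U, HasDerivAt (b m) (deriv (b m) t) t := fun m t ht =>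
      ((hb m).differentiableAt (hU.mem_nhds ht)).hasDerivAt
    have hpd : ∀ t ∈ U, HasFDerivAt p (∑ m ∈ Finset.range α,
        ((starRingEnd ℂ) t ^ (m + 1) • (((m : ℂ) + 1)⁻¹ •
            ((ContinuousLinearMap.toSpanSingleton ℂ (deriv (b m) t)).restrictScalars ℝ)) +
          (((m : ℂ) + 1)⁻¹ * b m t) • (((m + 1 : ℕ) • (starRingEnd ℂ) t ^ m) •
            (Complex.conjCLE : ℂ →L[ℝ] ℂ)))) t := by
      intro t ht
      refine HasFDerivAt.fun_sum fun m _ => ?_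
      have h1 : HasFDerivAt (fun t : ℂ => (starRingEnd ℂ) t) (Complex.conjCLE : ℂ →L[ℝ] ℂ) t :=
        Complex.conjCLE.hasFDerivAt
      have h2 := h1.pow (m + 1)
      have h3 := ((hbt m t ht).hasFDerivAt.restrictScalars ℝ).const_mul (((m : ℂ) + 1)⁻¹)
      exact h2.mul h3
    have hdiff : ∀ t ∈ U, DifferentiableAt ℂ (fun t => g 0 t - p t) t := by
      intro t ht
      rw [differentiableAt_complex_iff_differentiableAt_real]
      have hd0 := (hd 0 (by omega) t ht).hasFDerivAt.sub (hpd t ht)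
      refine ⟨hd0.differentiableAt, ?_⟩
      have e0 := hg 0 (by omega) t ht
      have e1 := hgb t ht
      have key : fderiv ℝ (fun t => g 0 t - p t) t 1 +
          Complex.I * fderiv ℝ (fun t => g 0 t - p t) t Complex.I = 0 := by
        rw [show fderiv ℝ (fun t => g 0 t - p t) t = _ from hd0.fderiv]
        simp only [sub_apply, sum_apply]
        simp only [zero_add] at e0 e1
        rw [e1] at e0
        rw [mul_sub, ← add_sub_add_comm, e0, Finset.mul_sum, Finset.mul_sum,
          ← Finset.sum_add_distrib, ← Finset.sum_sub_distrib]
        refine Finset.sum_eq_zero fun m _ => ?_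
        have hm : (m : ℂ) + 1 ≠ 0 := Nat.cast_add_one_ne_zero m
        simp
        field_simp
        linear_combination ((starRingEnd ℂ) t ^ (m + 1) * deriv (b m) t -
          (m + 1) * (starRingEnd ℂ) t ^ m * b m t) * (-Complex.I_sq)
      rw [smul_eq_mul]
      linear_combination (-Complex.I) * key +
        fderiv ℝ (fun t => g 0 t - p t) t Complex.I * Complex.I_sq
    refine ⟨fun m => Nat.casesOn m (fun t => g 0 t - p t) fun m t => ((m : ℂ) + 1)⁻¹ * b m t,
      ?_, ?_⟩
    · rintro (_ | m)
      · exact fun t ht => (hdiff t ht).differentiableWithinAt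
      · exact (hb m).const_mul _
    · intro t _
      rw [Finset.sum_range_succ']
      simp [hp]

/-- The coefficients of a polynomial are controlled by its values at distinct nodes. -/
lemma exists_bound_coeffs_of_nodes {α : ℕ} {s : Fin α → ℂ} (hs : Function.Injective s) :
    ∃ C : ℝ, 0 ≤ C ∧ ∀ (c : Fin α → ℂ) (M : ℝ), (∀ i, ‖∑ m : Fin α, s i ^ (m : ℕ) * c m‖ ≤ M) →
      ∀ m, ‖c m‖ ≤ C * M := by
  set V := Matrix.vandermonde s
  have hV : IsUnit V.det := (Matrix.det_vandermonde_ne_zero_iff.2 hs).isUnit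
  refine ⟨∑ m, ∑ i, ‖V⁻¹ m i‖, by positivity, fun c M hM m => ?_⟩
  have hc : c = V⁻¹.mulVec (V.mulVec c) := by
    rw [Matrix.mulVec_mulVec, Matrix.nonsing_inv_mul _ hV, Matrix.one_mulVec]
  have hM0 : 0 ≤ M := (norm_nonneg _).trans (hM m)
  calc ‖c m‖ = ‖∑ i, V⁻¹ m i * V.mulVec c i‖ := by
        conv_lhs => rw [hc]
        rfl
    _ ≤ ∑ i, ‖V⁻¹ m i‖ * M := by
        refine norm_sum_le_of_le _ fun i _ => ?_
        rw [norm_mul]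
        gcongr
        exact hM i
    _ = (∑ i, ‖V⁻¹ m i‖) * M := by rw [Finset.sum_mul]
    _ ≤ _ := mul_le_mul_of_nonneg_right (Finset.single_le_sum (f := fun m => ∑ i, ‖V⁻¹ m i‖)
        (fun _ _ => by positivity) (Finset.mem_univ m)) hM0

/-- Holomorphic coefficients of a polyanalytic function are controlled by that function. -/
lemma exists_bound_holomorphic_coeffs (α : ℕ) {r : ℝ} (hr : 0 < r) :
    ∃ C : ℝ, 0 ≤ C ∧ ∀ (a : ℕ → ℂ → ℂ), (∀ m, DifferentiableOn ℂ (a m) (ball 0 r)) →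
      ∀ M : ℝ, (∀ t ∈ ball (0 : ℂ) r,
        ‖∑ m ∈ Finset.range α, (starRingEnd ℂ) t ^ m * a m t‖ ≤ M) →
      ∀ m < α, ∀ t ∈ sphere (0 : ℂ) (r / 2), ‖a m t‖ ≤ C * M := by
  set ρ : Fin α → ℝ := fun i => r / 2 * (1 + i / (α + 1)) with hρ
  have hρ1 : ∀ i, r / 2 ≤ ρ i := fun i => le_mul_of_one_le_right (by positivity)
    (le_add_of_nonneg_right (by positivity))
  have hρ2 : ∀ i, ρ i < r := fun i => by
    have : (i : ℝ) / (α + 1) < 1 := by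
      rw [div_lt_one (by positivity)]
      exact_mod_cast i.2.trans (Nat.lt_succ_self α)
    calc ρ i < r / 2 * (1 + 1) := by simp only [hρ]; gcongr
      _ = r := by ring
  have hρ0 : ∀ i, 0 < ρ i := fun i => (half_pos hr).trans_le (hρ1 i)
  set s : Fin α → ℂ := fun i => ((ρ i : ℝ) : ℂ) ^ 2 with hs
  have hinj : Function.Injective s := by
    intro i k hik
    have h1 : (ρ i) ^ 2 = (ρ k) ^ 2 := by
      simp only [hs] at hik
      exact_mod_cast hik
    have h2 : ρ i = ρ k := (pow_left_inj₀ (hρ0 i).le (hρ0 k).le two_ne_zero).1 h1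
    simp only [hρ] at h2
    have h3 := mul_left_cancel₀ (half_pos hr).ne' h2
    have h4 := add_left_cancel h3
    rw [div_left_inj' (by positivity)] at h4
    exact Fin.ext (by exact_mod_cast h4)
  obtain ⟨C, hC0, hC⟩ := exists_bound_coeffs_of_nodes hinj
  refine ⟨∑ m ∈ Finset.range α, C * r ^ α / (r / 2) ^ (α - m), by positivity,
    fun a ha M hM m hm t ht => ?_⟩
  have hM0 : 0 ≤ M := (norm_nonneg _).trans (hM 0 (mem_ball_self hr))
  have hnt : ‖t‖ = r / 2 := by simpa using ht
  have hnode : ∀ i, ‖∑ m : Fin α, s i ^ (m : ℕ) * (t ^ (α - m) * a m t)‖ ≤ r ^ α * M := by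
    intro i
    have hsub : closure (ball (0 : ℂ) (ρ i)) ⊆ ball 0 r :=
      closure_ball_subset_closedBall.trans (closedBall_subset_ball (hρ2 i))
    have hdc : DiffContOnCl ℂ (fun t => ∑ m : Fin α, s i ^ (m : ℕ) * (t ^ (α - m) * a m t))
        (ball 0 (ρ i)) := by
      refine DifferentiableOn.diffContOnCl (DifferentiableOn.fun_sum fun m _ => ?_)
      exact (((differentiableOn_id.pow _).mul ((ha m).mono hsub))).const_mul _
    refine Complex.norm_le_of_forall_mem_frontier_norm_le isBounded_ball hdc (fun z hz => ?_) ?_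
    · rw [frontier_ball _ (hρ0 i).ne'] at hz
      have hz' : ‖z‖ = ρ i := by simpa using hz
      have hzs : s i = z * (starRingEnd ℂ) z := by
        rw [Complex.mul_conj, Complex.normSq_eq_norm_sq, hz']
        simp [hs]
      have heq : ∑ m : Fin α, s i ^ (m : ℕ) * (z ^ (α - m) * a m z) =
          z ^ α * ∑ m ∈ Finset.range α, (starRingEnd ℂ) z ^ m * a m z := by
        rw [← Fin.sum_univ_eq_sum_range (fun m => (starRingEnd ℂ) z ^ m * a m z), Finset.mul_sum]
        refine Finset.sum_congr rfl fun m _ => ?_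
        have : z ^ α = z ^ (α - m) * z ^ (m : ℕ) := by
          rw [← pow_add, Nat.sub_add_cancel m.2.le]
        rw [hzs, this, mul_pow]
        ring
      rw [heq, norm_mul, norm_pow, hz']
      have := hρ2 i
      have := hρ0 i
      gcongr
      exact hM z (by simpa [hz'] using hρ2 i)
    · rw [closure_ball _ (hρ0 i).ne', mem_closedBall_zero_iff, hnt]
      exact hρ1 i
  have hb := hC (fun m => t ^ (α - m) * a m t) _ hnode ⟨m, hm⟩
  simp only [norm_mul, norm_pow, hnt] at hb
  calc ‖a m t‖ ≤ C * r ^ α / (r / 2) ^ (α - m) * M := by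
        rw [div_mul_eq_mul_div, le_div_iff₀ (by positivity)]
        linarith
    _ ≤ _ := by
        gcongr
        exact Finset.single_le_sum (f := fun m => C * r ^ α / (r / 2) ^ (α - m))
          (fun _ _ => by positivity) (Finset.mem_range.2 hm)

/-- Cauchy estimate for the first derivative of a polyanalytic function of one variable. -/
lemma exists_bound_fderiv_of_iterated_dbar (α : ℕ) {r : ℝ} (hr : 0 < r) :
    ∃ C : ℝ, 0 ≤ C ∧ ∀ (g : ℕ → ℂ → ℂ),
      (∀ m < α, ∀ t ∈ ball (0 : ℂ) r, DifferentiableAt ℝ (g m) t) →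
      (∀ m < α, ∀ t ∈ ball (0 : ℂ) r,
        fderiv ℝ (g m) t 1 + Complex.I * fderiv ℝ (g m) t Complex.I = 2 * g (m + 1) t) →
      (∀ t ∈ ball (0 : ℂ) r, g α t = 0) →
      ∀ M : ℝ, (∀ t ∈ ball (0 : ℂ) r, ‖g 0 t‖ ≤ M) →
        ∀ v, ‖fderiv ℝ (g 0) 0 v‖ ≤ C * M * ‖v‖ := by
  obtain ⟨C, hC0, hC⟩ := exists_bound_holomorphic_coeffs α hr
  refine ⟨∑ m ∈ Finset.range α, (C / (r / 2) + m * C), by positivity,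
    fun g hd hg h0 M hM v => ?_⟩
  obtain ⟨a, ha, hga⟩ := exists_holomorphic_coeffs isOpen_ball α g hd hg h0
  have hM0 : 0 ≤ M := (norm_nonneg _).trans (hM 0 (mem_ball_self hr))
  have hsph := hC a ha M fun t ht => hga t ht ▸ hM t ht
  have hr2 : 0 < r / 2 := half_pos hr
  have hdc : ∀ m, DiffContOnCl ℂ (a m) (ball 0 (r / 2)) := fun m =>
    DifferentiableOn.diffContOnCl ((ha m).mono (closure_ball_subset_closedBall.trans
      (closedBall_subset_ball (half_lt_self hr))))
  have hderiv : ∀ m < α, ‖deriv (a m) 0‖ ≤ C * M / (r / 2) := fun m hm =>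
    Complex.norm_deriv_le_of_forall_mem_sphere_norm_le hr2 (hdc m) (hsph m hm)
  have hval : ∀ m < α, ‖a m 0‖ ≤ C * M := fun m hm =>
    Complex.norm_le_of_forall_mem_frontier_norm_le isBounded_ball (hdc m)
      (by simpa only [frontier_ball _ hr2.ne'] using hsph m hm)
      (subset_closure (mem_ball_self hr2))
  have hF : HasFDerivAt (g 0) (∑ m ∈ Finset.range α,
      ((starRingEnd ℂ) (0 : ℂ) ^ m •
          ((ContinuousLinearMap.toSpanSingleton ℂ (deriv (a m) 0)).restrictScalars ℝ) +
        a m 0 • ((m • (starRingEnd ℂ) (0 : ℂ) ^ (m - 1)) •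
          (Complex.conjCLE : ℂ →L[ℝ] ℂ)))) 0 := by
    refine HasFDerivAt.congr_of_eventuallyEq (HasFDerivAt.fun_sum fun m _ => ?_)
      (eventually_of_mem (ball_mem_nhds 0 hr) hga)
    have h1 : HasFDerivAt (fun t : ℂ => (starRingEnd ℂ) t) (Complex.conjCLE : ℂ →L[ℝ] ℂ) 0 :=
      Complex.conjCLE.hasFDerivAt
    have h2 := h1.pow m
    have h3 := ((ha m).differentiableAt
      (ball_mem_nhds 0 hr)).hasDerivAt.hasFDerivAt.restrictScalars ℝ
    exact h2.mul h3
  have hpow : ∀ k : ℕ, ‖(0 : ℂ) ^ k‖ ≤ 1 := fun k => by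
    rw [norm_pow, norm_zero]
    exact pow_le_one₀ le_rfl zero_le_one
  rw [hF.fderiv, sum_apply, Finset.sum_mul, Finset.sum_mul]
  refine norm_sum_le_of_le _ fun m hm => ?_
  have hm' := Finset.mem_range.1 hm
  simp only [map_zero, nsmul_eq_mul, add_apply,
    smul_apply, ContinuousLinearMap.coe_restrictScalars',
    ContinuousLinearMap.toSpanSingleton_apply, smul_eq_mul, ContinuousLinearEquiv.coe_coe,
    Complex.conjCLE_apply]
  calc _ ≤ ‖(0 : ℂ) ^ m‖ * (‖v‖ * ‖deriv (a m) 0‖) +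
        ‖a m 0‖ * (m * ‖(0 : ℂ) ^ (m - 1)‖ * ‖v‖) := by
        refine (norm_add_le _ _).trans (le_of_eq ?_)
        simp only [norm_mul, RCLike.norm_conj, RCLike.norm_natCast]
    _ ≤ 1 * (‖v‖ * (C * M / (r / 2))) + C * M * (m * 1 * ‖v‖) := by
        gcongr
        exacts [hpow _, hderiv m hm', hval m hm', hpow _]
    _ = _ := by ring

section Wirtinger

variable {n : ℕ} {Ω : Set (Fin n → ℂ)} {f g : (Fin n → ℂ) → ℂ}

lemma contDiffOn_fderiv_apply (hΩ : IsOpen Ω) (hf : ContDiffOn ℝ (⊤ : ℕ∞) f Ω)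
    (v : Fin n → ℂ) : ContDiffOn ℝ (⊤ : ℕ∞) (fun z => fderiv ℝ f z v) Ω :=
  ((contDiffOn_infty_iff_fderiv_of_isOpen hΩ).1 hf).2.clm_apply contDiffOn_const

lemma differentiableAt_of_contDiffOn (hΩ : IsOpen Ω) (hf : ContDiffOn ℝ (⊤ : ℕ∞) f Ω)
    {z : Fin n → ℂ} (hz : z ∈ Ω) : DifferentiableAt ℝ f z :=
  (hf.contDiffAt (hΩ.mem_nhds hz)).differentiableAt (by simp)

lemma contDiffOn_wirtingerBar (hΩ : IsOpen Ω) (hf : ContDiffOn ℝ (⊤ : ℕ∞) f Ω) (j : Fin n) :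
    ContDiffOn ℝ (⊤ : ℕ∞) (wirtingerBar n j f) Ω :=
  contDiffOn_const.mul ((contDiffOn_fderiv_apply hΩ hf _).add
    (contDiffOn_const.mul (contDiffOn_fderiv_apply hΩ hf _)))

lemma contDiffOn_wirtingerBar_iterate (hΩ : IsOpen Ω) (hf : ContDiffOn ℝ (⊤ : ℕ∞) f Ω)
    (j : Fin n) (m : ℕ) : ContDiffOn ℝ (⊤ : ℕ∞) ((wirtingerBar n j)^[m] f) Ω := by
  induction m with
  | zero => exact hf
  | succ m ih =>
    rw [Function.iterate_succ_apply']
    exact contDiffOn_wirtingerBar hΩ ih j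

lemma wirtingerBar_congr (hΩ : IsOpen Ω) (hfg : EqOn f g Ω) (j : Fin n) :
    EqOn (wirtingerBar n j f) (wirtingerBar n j g) Ω := fun z hz => by
  simp only [wirtingerBar, (hfg.eventuallyEq_of_mem (hΩ.mem_nhds hz)).fderiv_eq]

lemma wirtingerBar_iterate_congr (hΩ : IsOpen Ω) (hfg : EqOn f g Ω) (j : Fin n) (m : ℕ) :
    EqOn ((wirtingerBar n j)^[m] f) ((wirtingerBar n j)^[m] g) Ω := by
  induction m with
  | zero => exact hfg
  | succ m ih =>
    rw [Function.iterate_succ_apply', Function.iterate_succ_apply']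
    exact wirtingerBar_congr hΩ ih j

lemma wirtingerBar_iterate_comm (hΩ : IsOpen Ω) (j : Fin n)
    {T : ((Fin n → ℂ) → ℂ) → (Fin n → ℂ) → ℂ}
    (hT : ∀ g, ContDiffOn ℝ (⊤ : ℕ∞) g Ω →
      EqOn (wirtingerBar n j (T g)) (T (wirtingerBar n j g)) Ω)
    (hf : ContDiffOn ℝ (⊤ : ℕ∞) f Ω) (m : ℕ) :
    EqOn ((wirtingerBar n j)^[m] (T f)) (T ((wirtingerBar n j)^[m] f)) Ω := by
  induction m generalizing f with
  | zero => exact fun _ _ => rfl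
  | succ m ih =>
    rw [Function.iterate_succ_apply, Function.iterate_succ_apply]
    exact (wirtingerBar_iterate_congr hΩ (hT f hf) j m).trans
      (ih (contDiffOn_wirtingerBar hΩ hf j))

lemma wirtingerBar_add (hΩ : IsOpen Ω) (hf : ContDiffOn ℝ (⊤ : ℕ∞) f Ω)
    (hg : ContDiffOn ℝ (⊤ : ℕ∞) g Ω) (j : Fin n) :
    EqOn (wirtingerBar n j (f + g)) (wirtingerBar n j f + wirtingerBar n j g) Ω := fun z hz => by
  simp only [wirtingerBar, Pi.add_apply, fderiv_add (differentiableAt_of_contDiffOn hΩ hf hz)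
    (differentiableAt_of_contDiffOn hΩ hg hz), add_apply]
  ring

lemma wirtingerBar_iterate_add (hΩ : IsOpen Ω) (hf : ContDiffOn ℝ (⊤ : ℕ∞) f Ω)
    (hg : ContDiffOn ℝ (⊤ : ℕ∞) g Ω) (j : Fin n) (m : ℕ) :
    EqOn ((wirtingerBar n j)^[m] (f + g))
      ((wirtingerBar n j)^[m] f + (wirtingerBar n j)^[m] g) Ω := by
  induction m with
  | zero => exact fun _ _ => rfl
  | succ m ih =>
    simp only [Function.iterate_succ_apply']
    exact (wirtingerBar_congr hΩ ih j).trans (wirtingerBar_add hΩ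
      (contDiffOn_wirtingerBar_iterate hΩ hf j m) (contDiffOn_wirtingerBar_iterate hΩ hg j m) j)

lemma wirtingerBar_const_mul (hΩ : IsOpen Ω) (hf : ContDiffOn ℝ (⊤ : ℕ∞) f Ω) (c : ℂ)
    (j : Fin n) :
    EqOn (wirtingerBar n j (fun z => c * f z)) (fun z => c * wirtingerBar n j f z) Ω :=
  fun z hz => by
    simp only [wirtingerBar, fderiv_const_mul (differentiableAt_of_contDiffOn hΩ hf hz),
      smul_apply, smul_eq_mul]
    ring

lemma wirtingerBar_fderiv_apply (hΩ : IsOpen Ω) (hf : ContDiffOn ℝ (⊤ : ℕ∞) f Ω)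
    (v : Fin n → ℂ) (j : Fin n) :
    EqOn (wirtingerBar n j (fun z => fderiv ℝ f z v))
      (fun z => fderiv ℝ (wirtingerBar n j f) z v) Ω := fun z hz => by
  have hd : DifferentiableAt ℝ (fderiv ℝ f) z :=
    (((contDiffOn_infty_iff_fderiv_of_isOpen hΩ).1 hf).2.differentiableOn
      (by simp)).differentiableAt (hΩ.mem_nhds hz)
  have hsymm : IsSymmSndFDerivAt ℝ f z :=
    ((contDiffOn_infty.1 hf 2).contDiffAt (hΩ.mem_nhds hz)).isSymmSndFDerivAt (by simp)
  have hD : ∀ w, HasFDerivAt (fun z => fderiv ℝ f z w) ((fderiv ℝ (fderiv ℝ f) z).flip w) z :=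
    fun w => by simpa using hd.hasFDerivAt.clm_apply (hasFDerivAt_const w z)
  have hW : HasFDerivAt (wirtingerBar n j f) _ z :=
    ((hD (Pi.single j 1)).add ((hD (Pi.single j Complex.I)).const_mul Complex.I)).const_mul
      (1 / 2 : ℂ)
  simp only [hW.fderiv]
  simp only [wirtingerBar, (hD v).fderiv, add_apply, smul_apply, smul_eq_mul,
    ContinuousLinearMap.flip_apply]
  rw [hsymm.eq v, hsymm.eq v]

end Wirtinger

namespace PolyanalyticOn

variable {n : ℕ} {α : Fin n → ℕ} {Ω : Set (Fin n → ℂ)} {f g : (Fin n → ℂ) → ℂ}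

lemma mono {Ω' : Set (Fin n → ℂ)} (hf : PolyanalyticOn n α f Ω) (h : Ω' ⊆ Ω) :
    PolyanalyticOn n α f Ω' :=
  ⟨hf.1.mono h, fun j z hz => hf.2 j z (h hz)⟩

lemma add (hΩ : IsOpen Ω) (hf : PolyanalyticOn n α f Ω) (hg : PolyanalyticOn n α g Ω) :
    PolyanalyticOn n α (f + g) Ω :=
  ⟨hf.1.add hg.1, fun j z hz => by
    rw [wirtingerBar_iterate_add hΩ hf.1 hg.1 j _ hz, Pi.add_apply, hf.2 j z hz, hg.2 j z hz,
      add_zero]⟩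

lemma const_mul (hΩ : IsOpen Ω) (hf : PolyanalyticOn n α f Ω) (c : ℂ) :
    PolyanalyticOn n α (fun z => c * f z) Ω :=
  ⟨contDiffOn_const.mul hf.1, fun j z hz => by
    rw [wirtingerBar_iterate_comm hΩ j (T := fun f z => c * f z)
      (fun g hg => wirtingerBar_const_mul hΩ hg c j) hf.1 _ hz]
    simp only [hf.2 j z hz, mul_zero]⟩

lemma sub (hΩ : IsOpen Ω) (hf : PolyanalyticOn n α f Ω) (hg : PolyanalyticOn n α g Ω) :
    PolyanalyticOn n α (f - g) Ω := by
  convert hf.add hΩ (hg.const_mul hΩ (-1)) using 1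
  ext z
  simp [sub_eq_add_neg]

lemma fderiv_apply (hΩ : IsOpen Ω) (hf : PolyanalyticOn n α f Ω) (v : Fin n → ℂ) :
    PolyanalyticOn n α (fun z => fderiv ℝ f z v) Ω :=
  ⟨contDiffOn_fderiv_apply hΩ hf.1 v, fun j z hz => by
    rw [wirtingerBar_iterate_comm hΩ j (T := fun f z => fderiv ℝ f z v)
      (fun g hg => wirtingerBar_fderiv_apply hΩ hg v j) hf.1 _ hz]
    have h0 : EqOn ((wirtingerBar n j)^[α j] f) (fun _ => 0) Ω := hf.2 j
    simp [(h0.eventuallyEq_of_mem (hΩ.mem_nhds hz)).fderiv_eq]⟩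

lemma wirtingerBar (hΩ : IsOpen Ω) (hf : PolyanalyticOn n α f Ω) (j : Fin n) :
    PolyanalyticOn n α (wirtingerBar n j f) Ω :=
  ((hf.fderiv_apply hΩ _).add hΩ ((hf.fderiv_apply hΩ _).const_mul hΩ _)).const_mul hΩ _

/-- Cauchy estimate for the first derivative of a polyanalytic function. -/
lemma exists_bound_fderiv (α : Fin n → ℕ) {r : ℝ} (hr : 0 < r) :
    ∃ C : ℝ, 0 ≤ C ∧ ∀ (f : (Fin n → ℂ) → ℂ) (z : Fin n → ℂ),
      PolyanalyticOn n α f (ball z r) → ∀ M : ℝ, (∀ w ∈ ball z r, ‖f w‖ ≤ M) →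
        ‖fderiv ℝ f z‖ ≤ C * M := by
  choose C hC0 hC using fun j => exists_bound_fderiv_of_iterated_dbar (α j) hr
  refine ⟨∑ j, C j, Finset.sum_nonneg fun j _ => hC0 j, fun f z hf M hM => ?_⟩
  have hM0 : 0 ≤ M := (norm_nonneg _).trans (hM z (mem_ball_self hr))
  have hslice : ∀ j v, ‖fderiv ℝ f z (Pi.single j v)‖ ≤ C j * M * ‖v‖ := by
    intro j v
    have hmem : ∀ t ∈ ball (0 : ℂ) r, z + Pi.single j t ∈ ball z r := fun t ht => by
      simpa [mem_ball_iff_norm, Pi.norm_single] using ht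
    have hsm := contDiffOn_wirtingerBar_iterate isOpen_ball hf.1 j
    have hder : ∀ m, ∀ t ∈ ball (0 : ℂ) r,
        HasFDerivAt (fun t => (_root_.wirtingerBar n j)^[m] f (z + Pi.single j t))
          ((fderiv ℝ ((_root_.wirtingerBar n j)^[m] f) (z + Pi.single j t)).comp
            (ContinuousLinearMap.single ℝ (fun _ : Fin n => ℂ) j)) t := fun m t ht =>
      (differentiableAt_of_contDiffOn isOpen_ball (hsm m) (hmem t ht)).hasFDerivAt.comp t
        (((ContinuousLinearMap.single ℝ (fun _ : Fin n => ℂ) j).hasFDerivAt (x := t)).const_add z)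
    have hzero : ∀ t ∈ ball (0 : ℂ) r,
        (_root_.wirtingerBar n j)^[α j] f (z + Pi.single j t) = 0 := fun t ht =>
      hf.2 j _ (hmem t ht)
    have hbound : ∀ t ∈ ball (0 : ℂ) r,
        ‖(_root_.wirtingerBar n j)^[0] f (z + Pi.single j t)‖ ≤ M := fun t ht =>
      hM _ (hmem t ht)
    have h := hC j (fun m t => (_root_.wirtingerBar n j)^[m] f (z + Pi.single j t))
      (fun m _ t ht => (hder m t ht).differentiableAt)
      (fun m _ t ht => by
        rw [(hder m t ht).fderiv, Function.iterate_succ_apply']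
        simp [_root_.wirtingerBar]) hzero M hbound v
    rw [(hder 0 0 (mem_ball_self hr)).fderiv] at h
    simpa using h
  refine ContinuousLinearMap.opNorm_le_bound _
    (mul_nonneg (Finset.sum_nonneg fun j _ => hC0 j) hM0) fun v => ?_
  calc ‖fderiv ℝ f z v‖ = ‖∑ j, fderiv ℝ f z (Pi.single j (v j))‖ := by
        rw [← map_sum, Finset.univ_sum_single]
    _ ≤ ∑ j, C j * M * ‖v‖ := norm_sum_le_of_le _ fun j _ => (hslice j (v j)).trans
        (mul_le_mul_of_nonneg_left (norm_le_pi_norm v j) (mul_nonneg (hC0 j) hM0))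
    _ = _ := by rw [← Finset.sum_mul, ← Finset.sum_mul]

/-- Locally uniform limits of polyanalytic functions may be differentiated termwise. -/
lemma tendstoLocallyUniformlyOn_fderiv (hΩ : IsOpen Ω) {f : ℕ → (Fin n → ℂ) → ℂ}
    {F : (Fin n → ℂ) → ℂ} (hf : ∀ k, PolyanalyticOn n α (f k) Ω)
    (hF : TendstoLocallyUniformlyOn f F atTop Ω) :
    DifferentiableOn ℝ F Ω ∧
      TendstoLocallyUniformlyOn (fun k => fderiv ℝ (f k)) (fderiv ℝ F) atTop Ω := by
  have hcauchy : ∀ z ∈ Ω, ∃ r > 0, ball z r ⊆ Ω ∧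
      UniformCauchySeqOn (fun k => fderiv ℝ (f k)) atTop (ball z r) := by
    intro z hz
    obtain ⟨R, hR, hRΩ⟩ := nhds_basis_closedBall.mem_iff.1 (hΩ.mem_nhds hz)
    have hr : 0 < R / 2 := half_pos hR
    have hsub : ∀ w ∈ ball z (R / 2), ball w (R / 2) ⊆ closedBall z R := fun w hw =>
      (ball_subset_ball' (by linarith [mem_ball.1 hw])).trans ball_subset_closedBall
    refine ⟨R / 2, hr, (ball_subset_closedBall.trans
      (closedBall_subset_closedBall (half_le_self hR.le))).trans hRΩ, ?_⟩
    obtain ⟨C, hC0, hC⟩ := exists_bound_fderiv α hr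
    have hu := ((tendstoLocallyUniformlyOn_iff_forall_isCompact hΩ).1 hF _ hRΩ
      (isCompact_closedBall z R)).uniformCauchySeqOn
    rw [Metric.uniformCauchySeqOn_iff] at hu ⊢
    intro ε hε
    obtain ⟨N, hN⟩ := hu (ε / (C + 1)) (by positivity)
    refine ⟨N, fun k hk l hl w hw => ?_⟩
    have hw' := (hsub w hw).trans hRΩ
    have hb := hC _ w (((hf k).sub hΩ (hf l)).mono hw') (ε / (C + 1)) fun x hx => by
      simpa [dist_eq_norm] using (hN k hk l hl x (hsub w hw hx)).le
    have hwΩ := hw' (mem_ball_self hr)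
    rw [fderiv_sub (differentiableAt_of_contDiffOn hΩ (hf k).1 hwΩ)
      (differentiableAt_of_contDiffOn hΩ (hf l).1 hwΩ)] at hb
    rw [dist_eq_norm]
    refine hb.trans_lt ?_
    rw [mul_div_assoc', div_lt_iff₀ (by positivity)]
    nlinarith
  have hlim : ∀ z, ∃ L, z ∈ Ω → Tendsto (fun k => fderiv ℝ (f k) z) atTop (𝓝 L) := fun z => by
    by_cases hz : z ∈ Ω
    · obtain ⟨r, hr, -, hu⟩ := hcauchy z hz
      obtain ⟨L, hL⟩ := cauchySeq_tendsto_of_complete (hu.cauchySeq (mem_ball_self hr))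
      exact ⟨L, fun _ => hL⟩
    · exact ⟨0, fun h => absurd h hz⟩
  choose G hG using hlim
  have hunif : TendstoLocallyUniformlyOn (fun k => fderiv ℝ (f k)) G atTop Ω := by
    intro u hu z hz
    obtain ⟨r, hr, hsub, hc⟩ := hcauchy z hz
    exact ⟨ball z r, mem_nhdsWithin_of_mem_nhds (ball_mem_nhds z hr),
      hc.tendstoUniformlyOn_of_tendsto (fun w hw => hG w (hsub hw)) u hu⟩
  have hder : ∀ z ∈ Ω, HasFDerivAt F (G z) z := fun z hz =>
    hasFDerivAt_of_tendstoLocallyUniformlyOn hΩ hunif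
      (fun k w hw => (differentiableAt_of_contDiffOn hΩ (hf k).1 hw).hasFDerivAt)
      (fun w hw => hF.tendsto_at hw) hz
  exact ⟨fun z hz => (hder z hz).differentiableAt.differentiableWithinAt,
    hunif.congr_right fun z hz => (hder z hz).fderiv.symm⟩

lemma contDiffOn_of_tendstoLocallyUniformlyOn (hΩ : IsOpen Ω) {f : ℕ → (Fin n → ℂ) → ℂ}
    {F : (Fin n → ℂ) → ℂ} (hf : ∀ k, PolyanalyticOn n α (f k) Ω)
    (hF : TendstoLocallyUniformlyOn f F atTop Ω) (m : ℕ) : ContDiffOn ℝ m F Ω := by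
  induction m generalizing f F with
  | zero =>
    simpa using (tendstoLocallyUniformlyOn_fderiv hΩ hf hF).1.continuousOn
  | succ m ih =>
    obtain ⟨hd, hu⟩ := tendstoLocallyUniformlyOn_fderiv hΩ hf hF
    rw [Nat.cast_succ, contDiffOn_succ_iff_fderiv_of_isOpen hΩ]
    refine ⟨hd, by simp, contDiffOn_clm_apply.2 fun v => ?_⟩
    exact ih (fun k => (hf k).fderiv_apply hΩ v)
      ((ContinuousLinearMap.apply ℝ ℂ v).uniformContinuous.comp_tendstoLocallyUniformlyOn hu)

lemma tendstoLocallyUniformlyOn_wirtingerBar (hΩ : IsOpen Ω) {f : ℕ → (Fin n → ℂ) → ℂ}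
    {F : (Fin n → ℂ) → ℂ} (hf : ∀ k, PolyanalyticOn n α (f k) Ω)
    (hF : TendstoLocallyUniformlyOn f F atTop Ω) (j : Fin n) :
    TendstoLocallyUniformlyOn (fun k => _root_.wirtingerBar n j (f k))
      (_root_.wirtingerBar n j F) atTop Ω := by
  let W : ((Fin n → ℂ) →L[ℝ] ℂ) →L[ℝ] ℂ := (1 / 2 : ℂ) •
    (ContinuousLinearMap.apply ℝ ℂ (Pi.single j 1) +
      Complex.I • ContinuousLinearMap.apply ℝ ℂ (Pi.single j Complex.I))
  exact W.uniformContinuous.comp_tendstoLocallyUniformlyOn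
    (tendstoLocallyUniformlyOn_fderiv hΩ hf hF).2

lemma tendstoLocallyUniformlyOn_wirtingerBar_iterate (hΩ : IsOpen Ω)
    {f : ℕ → (Fin n → ℂ) → ℂ} {F : (Fin n → ℂ) → ℂ} (hf : ∀ k, PolyanalyticOn n α (f k) Ω)
    (hF : TendstoLocallyUniformlyOn f F atTop Ω) (j : Fin n) (m : ℕ) :
    TendstoLocallyUniformlyOn (fun k => (_root_.wirtingerBar n j)^[m] (f k))
      ((_root_.wirtingerBar n j)^[m] F) atTop Ω := by
  induction m generalizing f F with
  | zero => exact hF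
  | succ m ih =>
    exact ih (fun k => (hf k).wirtingerBar hΩ j)
      (tendstoLocallyUniformlyOn_wirtingerBar hΩ hf hF j)

/-- A locally uniform limit of polyanalytic functions of order `α` is polyanalytic of
order `α`. -/
lemma of_tendstoLocallyUniformlyOn (hΩ : IsOpen Ω) {f : ℕ → (Fin n → ℂ) → ℂ}
    {F : (Fin n → ℂ) → ℂ} (hf : ∀ k, PolyanalyticOn n α (f k) Ω)
    (hF : TendstoLocallyUniformlyOn f F atTop Ω) : PolyanalyticOn n α F Ω := by
  refine ⟨contDiffOn_infty.2 (contDiffOn_of_tendstoLocallyUniformlyOn hΩ hf hF),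
    fun j z hz => ?_⟩
  have h := (tendstoLocallyUniformlyOn_wirtingerBar_iterate hΩ hf hF j (α j)).tendsto_at hz
  simp only [(hf _).2 j z hz] at h
  exact tendsto_nhds_unique h tendsto_const_nhds

end PolyanalyticOn

theorem uniform_limit_alpha_analytic
    (n : ℕ) (Ω : Set (Fin n → ℂ)) (hopen : IsOpen Ω) (hconn : IsConnected Ω)
    (α : Fin n → ℕ) (hα : ∀ j, 0 < α j)
    (f : ℕ → (Fin n → ℂ) → ℂ) (F : (Fin n → ℂ) → ℂ)
    (hfa : ∀ k : ℕ, PolyanalyticOn n α (f k) Ω)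
    (hconv : TendstoUniformlyOn f F Filter.atTop Ω) :
    PolyanalyticOn n α F Ω :=
  PolyanalyticOn.of_tendstoLocallyUniformlyOn hopen hfa hconv.tendstoLocallyUniformlyOn
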